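/- If a location lc occurs in all_locations c PTop, then for either Boolean flag b, every location appearing as the first component of an element of synt_step_image (lc, b) also occurs in all_locations c PTop; i.e., set (map fst (synt_step_image (lc, b))) ⊆ set (all_locations c PTop). -/

import Mathlib

/-! Language: values, expressions, statements, zipper paths -/

abbrev vname := String

inductive val where
  | Bool : Bool → val
  | Null : val
deriving DecidableEq

inductive expr where
  | Val : val → expr
  | Var : vname → expr
deriving DecidableEq

inductive stmt where
  | Empty : stmt
  | Assign : vname → val → stmt
  | Seq : stmt → stmt → stmt
  | Cond : expr → stmt → stmt → stmt
  | While : expr → stmt → stmt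
deriving DecidableEq

inductive stmt_path where
  | PTop : stmt_path
  | PSeqLeft : stmt_path → stmt → stmt_path
  | PSeqRight : stmt → stmt_path → stmt_path
  | PCondLeft : expr → stmt_path → stmt → stmt_path
  | PCondRight : expr → stmt → stmt_path → stmt_path
  | PWhile : expr → stmt_path → stmt_path
deriving DecidableEq

inductive stmt_location where
  | Loc : stmt → stmt_path → stmt_location
deriving DecidableEq

abbrev synt_config := stmt_location × Bool

abbrev state := vname → Option val

def eval : expr → state → val
  | expr.Val v, _ => v
  | expr.Var x, s => (s x).getD val.Null

open stmt stmt_path stmt_location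

def next_loc : stmt → stmt_path → stmt_location × Bool
  | c, PTop => (Loc c PTop, false)
  | c, PSeqLeft sp c2 => (Loc c2 (PSeqRight c sp), true)
  | c, PSeqRight c1 sp => (Loc (Seq c1 c) sp, false)
  | c, PCondLeft e sp c2 => (Loc (Cond e c c2) sp, false)
  | c, PCondRight e c1 sp => (Loc (Cond e c1 c) sp, false)
  | c, PWhile e sp => (Loc (While e c) sp, true)

/-- Small-step operational semantics on semantic configurations. -/
inductive smallStep : synt_config × state → synt_config × state → Prop where
  | SEmpty (sp : stmt_path) (s : state) :
      smallStep ((Loc Empty sp, true), s) ((Loc Empty sp, false), s)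
  | SAssign (vr : vname) (vl : val) (sp : stmt_path) (s : state) :
      smallStep ((Loc (Assign vr vl) sp, true), s)
                ((Loc (Assign vr vl) sp, false), Function.update s vr (some vl))
  | SSeq (c1 c2 : stmt) (sp : stmt_path) (s : state) :
      smallStep ((Loc (Seq c1 c2) sp, true), s) ((Loc c1 (PSeqLeft sp c2), true), s)
  | SCondT (e : expr) (c1 c2 : stmt) (sp : stmt_path) (s : state) :
      eval e s = val.Bool true →
      smallStep ((Loc (Cond e c1 c2) sp, true), s) ((Loc c1 (PCondLeft e sp c2), true), s)
  | SCondF (e : expr) (c1 c2 : stmt) (sp : stmt_path) (s : state) :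
      eval e s = val.Bool false →
      smallStep ((Loc (Cond e c1 c2) sp, true), s) ((Loc c2 (PCondRight e c1 sp), true), s)
  | SWhileT (e : expr) (c : stmt) (sp : stmt_path) (s : state) :
      eval e s = val.Bool true →
      smallStep ((Loc (While e c) sp, true), s) ((Loc c (PWhile e sp), true), s)
  | SWhileF (e : expr) (c : stmt) (sp : stmt_path) (s : state) :
      eval e s = val.Bool false →
      smallStep ((Loc (While e c) sp, true), s) ((Loc (While e c) sp, false), s)
  | SFalse (c : stmt) (sp : stmt_path) (s : state) :
      sp ≠ PTop →
      smallStep ((Loc c sp, false), s) (next_loc c sp, s)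

/-! Automata -/

inductive action where
  | NoAct : action
  | AssAct : vname → val → action
deriving DecidableEq

structure edge (n : Type) where
  source : n
  action : action
  dest : n
deriving DecidableEq

structure ta (n : Type) where
  nodes : List n
  edges : List (edge n)
  init_s : n

def action_effect : action → state → state
  | action.NoAct, s => s
  | action.AssAct x v, s => Function.update s x (some v)

/-- Automaton transition semantics. -/
def ta_step {n : Type} (aut : ta n) (p q : n × state) : Prop :=
  ∃ e ∈ aut.edges, e.source = p.1 ∧ e.dest = q.1 ∧ q.2 = action_effect e.action p.2

def synt_step_image : synt_config → List synt_config
  | (Loc stmt.Empty sp, true) => [(Loc stmt.Empty sp, false)]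
  | (Loc (stmt.Assign vr vl) sp, true) => [(Loc (stmt.Assign vr vl) sp, false)]
  | (Loc (stmt.Seq c1 c2) sp, true) => [(Loc c1 (PSeqLeft sp c2), true)]
  | (Loc (stmt.Cond e c1 c2) sp, true) =>
      [(Loc c1 (PCondLeft e sp c2), true), (Loc c2 (PCondRight e c1 sp), true)]
  | (Loc (stmt.While e c) sp, true) =>
      [(Loc c (PWhile e sp), true), (Loc (stmt.While e c) sp, false)]
  | (Loc c sp, false) => if sp = PTop then [] else [next_loc c sp]

def action_of_synt_config : synt_config → action
  | (Loc (stmt.Assign vn vl) _, true) => action.AssAct vn vl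
  | _ => action.NoAct

def synt_step_image_closed (aut : ta synt_config) : Prop :=
  ∀ n ∈ aut.nodes, ∀ t ∈ synt_step_image n,
    t ∈ aut.nodes ∧
    (⟨n, action_of_synt_config n, t⟩ : edge synt_config) ∈ aut.edges

def all_locations : stmt → stmt_path → List stmt_location
  | stmt.Empty, sp => [Loc stmt.Empty sp]
  | stmt.Assign vr vl, sp => [Loc (stmt.Assign vr vl) sp]
  | stmt.Seq c1 c2, sp =>
      Loc (stmt.Seq c1 c2) sp ::
        (all_locations c1 (PSeqLeft sp c2) ++ all_locations c2 (PSeqRight c1 sp))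
  | stmt.Cond e c1 c2, sp =>
      Loc (stmt.Cond e c1 c2) sp ::
        (all_locations c1 (PCondLeft e sp c2) ++ all_locations c2 (PCondRight e c1 sp))
  | stmt.While e c, sp => Loc (stmt.While e c) sp :: all_locations c (PWhile e sp)

def nodes_of_stmt_locations (ls : List stmt_location) : List synt_config :=
  ls.flatMap (fun l => [(l, true), (l, false)])

def edge_of_synt_config (s : synt_config) : List (edge synt_config) :=
  (synt_step_image s).map (fun t => ⟨s, action_of_synt_config s, t⟩)

def edges_of_nodes (nds : List synt_config) : List (edge synt_config) :=
  nds.flatMap edge_of_synt_config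

def stmt_to_ta (c : stmt) : ta synt_config :=
  let nds := nodes_of_stmt_locations (all_locations c PTop)
  ⟨nds, edges_of_nodes nds, (Loc c PTop, true)⟩

/-- The statement obtained by filling the hole of a path. -/
def plug : stmt → stmt_path → stmt
  | c, PTop => c
  | c, PSeqLeft sp c2 => plug (Seq c c2) sp
  | c, PSeqRight c1 sp => plug (Seq c1 c) sp
  | c, PCondLeft e sp c2 => plug (Cond e c c2) sp
  | c, PCondRight e c1 sp => plug (Cond e c1 c) sp
  | c, PWhile e sp => plug (While e c) sp

def plug_loc : stmt_location → stmt
  | Loc c sp => plug c sp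

theorem plug_loc_of_mem_all_locations {l : stmt_location} {c : stmt} {sp : stmt_path}
    (h : l ∈ all_locations c sp) : plug_loc l = plug c sp := by
  induction c generalizing sp with
  | Empty | Assign =>
    simp only [all_locations, List.mem_singleton] at h
    rw [h, plug_loc]
  | Seq c1 c2 ih1 ih2 | Cond e c1 c2 ih1 ih2 =>
    simp only [all_locations, List.mem_cons, List.mem_append] at h
    rcases h with rfl | h | h
    · rfl
    · exact ih1 h
    · exact ih2 h
  | While e c ih =>
    simp only [all_locations, List.mem_cons] at h
    rcases h with rfl | h
    · rfl
    · exact ih h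

theorem all_locations_subset_plug (c : stmt) (sp : stmt_path) :
    all_locations c sp ⊆ all_locations (plug c sp) PTop := by
  induction sp generalizing c with
  | PTop => exact List.Subset.refl _
  | PSeqLeft _ _ ih | PSeqRight _ _ ih | PCondLeft _ _ _ ih | PCondRight _ _ _ ih
  | PWhile _ _ ih =>
    refine List.Subset.trans ?_ (ih _)
    intro l hl
    simp [all_locations, hl]

theorem mem_all_locations_self (c : stmt) (sp : stmt_path) :
    Loc c sp ∈ all_locations c sp := by
  cases c <;> simp [all_locations]

theorem mem_all_locations_PTop_iff {l : stmt_location} {c : stmt} :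
    l ∈ all_locations c PTop ↔ plug_loc l = c := by
  refine ⟨plug_loc_of_mem_all_locations, ?_⟩
  rintro rfl
  cases l
  exact all_locations_subset_plug _ _ (mem_all_locations_self _ _)

theorem plug_loc_next_loc (c : stmt) (sp : stmt_path) :
    plug_loc (next_loc c sp).1 = plug c sp := by
  cases sp <;> rfl

theorem plug_loc_of_mem_synt_step_image {l : stmt_location} {b : Bool} {t : synt_config}
    (h : t ∈ synt_step_image (l, b)) : plug_loc t.1 = plug_loc l := by
  obtain ⟨c, sp⟩ := l
  cases b with
  | false =>
    by_cases hsp : sp = PTop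
    · simp [synt_step_image, hsp] at h
    · simp only [synt_step_image, hsp, if_false, List.mem_singleton] at h
      rw [h]
      exact plug_loc_next_loc c sp
  | true =>
    cases c <;> simp only [synt_step_image, List.mem_cons, List.not_mem_nil, or_false] at h
    case Empty | Assign | Seq => subst h; rfl
    case Cond | While => rcases h with rfl | rfl <;> rfl

/-- if a location `lc` occurs in `all_locations c PTop`, then every
location appearing as the first component of an element of
`synt_step_image (lc, b)` also occurs in `all_locations c PTop`. -/
theorem synt_step_image_all_locations
    (c : stmt) (lc : stmt_location) (b : Bool)
    (h : lc ∈ all_locations c PTop) :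
    ∀ lc' ∈ (synt_step_image (lc, b)).map Prod.fst, lc' ∈ all_locations c PTop := by
  intro lc' hlc'
  obtain ⟨t, ht, rfl⟩ := List.mem_map.mp hlc'
  rw [mem_all_locations_PTop_iff] at h ⊢
  rw [plug_loc_of_mem_synt_step_image ht, h]
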